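/- For every n ≥ 0, the lattice L_n is comodernistic: every interval [x, y] of L_n with x < y contains a coatom of [x, y] which is left-modular in the lattice [x, y]. -/

import Mathlib

open scoped Classical

/-- An arithmetic progression of integers: a finite set of the form
`{a, a+r, ..., a+(k-1)r}` with `a : ℤ`, `r ≥ 1` and `k ≥ 0` (so the empty set and all
singletons are arithmetic progressions). -/
def IsAP (s : Finset ℤ) : Prop :=
  ∃ (a r : ℤ) (k : ℕ), 1 ≤ r ∧ s = (Finset.range k).image (fun i => a + (i : ℤ) * r)

/-- The number `p_{nk}` of arithmetic progressions of cardinality `k` contained in `{1,…,n}`. -/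
noncomputable def numAP (n k : ℕ) : ℕ :=
  ((Finset.Icc (1:ℤ) (n:ℤ)).powerset.filter (fun s => IsAP s ∧ s.card = k)).card

/-- The Möbius function of the poset of arithmetic progressions ordered by inclusion,
defined by `μ(x,x) = 1` and `μ(x,y) = -∑_{x ≤ z < y} μ(x,z)`, where `z` ranges over
arithmetic progressions with `x ⊆ z ⊂ y`.  (For `x ⊆ y ⊆ {1,…,n}`, all arithmetic
progressions `z` with `x ⊆ z ⊂ y` automatically lie in `L_n`, so this is the Möbius
function of any interval `[x, y]` of the lattice `L_n`.) -/
noncomputable def apMu (x y : Finset ℤ) : ℤ :=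
  if x = y then 1
  else - ∑ z ∈ (y.powerset.filter (fun z => IsAP z ∧ x ⊆ z ∧ z ≠ y)).attach, apMu x z.1
termination_by y.card
decreasing_by
  rename_i z
  have hz := z.2
  rw [Finset.mem_filter, Finset.mem_powerset] at hz
  exact Finset.card_lt_card (lt_of_le_of_ne hz.1 hz.2.2.2)

/-- The join of `a` and `b` in the lattice of arithmetic progressions contained in `t`:
the intersection of all arithmetic progressions contained in `t` that contain `a ∪ b`,
i.e. the smallest such progression. -/
noncomputable def apJoin (t a b : Finset ℤ) : Finset ℤ :=
  t.filter (fun v => ∀ z : Finset ℤ, IsAP z → z ⊆ t → a ∪ b ⊆ z → v ∈ z)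

/-- The meet (intersection) of a finite family `S` of subsets of the top element `t`;
the meet of the empty family is `t` itself. -/
def apMeet (t : Finset ℤ) (S : Finset (Finset ℤ)) : Finset ℤ :=
  S.fold (· ⊓ ·) t id

/-- `x` is a coatom of the lattice `L_n` of arithmetic progressions contained in
`{1,…,n}`: an element distinct from the maximum `{1,…,n}` with no element strictly
between it and the maximum. -/
def IsCoatomIn (n : ℕ) (x : Finset ℤ) : Prop :=
  IsAP x ∧ x ⊆ Finset.Icc (1:ℤ) (n:ℤ) ∧ x ≠ Finset.Icc (1:ℤ) (n:ℤ) ∧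
    ∀ y : Finset ℤ, IsAP y → y ⊆ Finset.Icc (1:ℤ) (n:ℤ) → x ⊂ y → y = Finset.Icc (1:ℤ) (n:ℤ)

/-- `y` is covered by `top` in the poset of arithmetic progressions: `y < top` and there
is no arithmetic progression strictly between them. -/
def CoveredIn (top y : Finset ℤ) : Prop :=
  IsAP y ∧ y ⊂ top ∧ ¬ ∃ z : Finset ℤ, IsAP z ∧ y ⊂ z ∧ z ⊂ top

/-- `c` is a maximal chain in the lattice `L_n` of arithmetic progressions contained
in `{1,…,n}`: a chain (under inclusion) of elements of `L_n` to which no further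
element of `L_n` can be added. -/
def IsMaxChainIn (n : ℕ) (c : Finset (Finset ℤ)) : Prop :=
  (∀ s ∈ c, IsAP s ∧ s ⊆ Finset.Icc (1:ℤ) (n:ℤ)) ∧
  IsChain (· ⊆ ·) (↑c : Set (Finset ℤ)) ∧
  ∀ z : Finset ℤ, IsAP z → z ⊆ Finset.Icc (1:ℤ) (n:ℤ) →
    IsChain (· ⊆ ·) (insert z (↑c : Set (Finset ℤ))) → z ∈ c

/-- The number `b_{nk}` of chains of length `k` (i.e. totally ordered subsets with `k+1`
elements) in `L_n` that contain both `∅` and `{1,…,n}`. -/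
noncomputable def numChains (n k : ℕ) : ℕ :=
  (((Finset.Icc (1:ℤ) (n:ℤ)).powerset.filter IsAP).powerset.filter
    (fun c : Finset (Finset ℤ) => c.card = k + 1 ∧ ∅ ∈ c ∧ Finset.Icc (1:ℤ) (n:ℤ) ∈ c ∧
      IsChain (· ⊆ ·) (↑c : Set (Finset ℤ)))).card

lemma isAP_iff {s : Finset ℤ} : IsAP s ↔
    ∃ (a r : ℤ) (k : ℕ), 1 ≤ r ∧ ∀ w, w ∈ s ↔ ∃ i : ℕ, i < k ∧ a + i * r = w := by
  simp only [IsAP, Finset.ext_iff]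
  simp

/-- The arithmetic progression with first element `a`, step `r` and last element at most `b`. -/
lemma isAP_of_mem_iff {s : Finset ℤ} {a b r : ℤ} (hr : 1 ≤ r)
    (h : ∀ w, w ∈ s ↔ a ≤ w ∧ w ≤ b ∧ r ∣ w - a) : IsAP s := by
  refine isAP_iff.2 ⟨a, r, ((b - a) / r + 1).toNat, hr, fun w => ?_⟩
  simp only [h, Int.lt_toNat]
  constructor
  · rintro ⟨haw, hwb, i, hi⟩
    have hi0 : 0 ≤ i := by nlinarith
    lift i to ℕ using hi0
    refine ⟨i, ?_, by linarith⟩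
    rw [Int.lt_add_one_iff, Int.le_ediv_iff_mul_le (by omega)]
    linarith
  · rintro ⟨i, hi, rfl⟩
    rw [Int.lt_add_one_iff, Int.le_ediv_iff_mul_le (by omega)] at hi
    have : 0 ≤ (i : ℤ) * r := by positivity
    exact ⟨by linarith, by linarith, i, by ring⟩

lemma IsAP.exists_mem_iff {s : Finset ℤ} (hs : IsAP s) (hne : s.Nonempty) :
    ∃ a b r : ℤ, 1 ≤ r ∧ a ≤ b ∧ r ∣ b - a ∧ ∀ w, w ∈ s ↔ a ≤ w ∧ w ≤ b ∧ r ∣ w - a := by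
  obtain ⟨a, r, k, hr, h⟩ := isAP_iff.1 hs
  obtain _ | k := k
  · obtain ⟨w, hw⟩ := hne
    simp [h] at hw
  have hkr : 0 ≤ (k : ℤ) * r := by positivity
  refine ⟨a, a + k * r, r, hr, by linarith, ⟨k, by ring⟩, fun w => ?_⟩
  rw [h]
  constructor
  · rintro ⟨i, hi, rfl⟩
    have : 0 ≤ (i : ℤ) * r := by positivity
    have hik : (i : ℤ) ≤ k := by omega
    exact ⟨by linarith, by nlinarith, i, by ring⟩
  · rintro ⟨haw, hwb, i, hi⟩
    have hi0 : 0 ≤ i := by nlinarith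
    lift i to ℕ using hi0
    have hik : (i : ℤ) ≤ k := by nlinarith
    exact ⟨i, by omega, by linarith⟩

/-- A progression contained in `[a, b]` and containing both `a` and `b` is determined by its
step. -/
lemma IsAP.exists_step {s : Finset ℤ} {a b : ℤ} (hs : IsAP s) (ha : a ∈ s) (hb : b ∈ s)
    (hab : ∀ w ∈ s, a ≤ w ∧ w ≤ b) :
    ∃ r : ℤ, 1 ≤ r ∧ r ∣ b - a ∧ ∀ w, w ∈ s ↔ a ≤ w ∧ w ≤ b ∧ r ∣ w - a := by
  obtain ⟨a', b', r, hr, hab', hdvd, h⟩ := hs.exists_mem_iff ⟨a, ha⟩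
  obtain rfl : a' = a :=
    le_antisymm ((h a).1 ha).1 (hab a' ((h a').2 ⟨le_rfl, hab', by simp⟩)).1
  obtain rfl : b' = b :=
    le_antisymm (hab b' ((h b').2 ⟨hab', le_rfl, hdvd⟩)).2 ((h b).1 hb).2.1
  exact ⟨r, hr, hdvd, h⟩

lemma subset_apJoin {t a b : Finset ℤ} (ha : a ⊆ t) (hb : b ⊆ t) : a ∪ b ⊆ apJoin t a b :=
  fun _ hw => Finset.mem_filter.2 ⟨Finset.union_subset ha hb hw, fun _ _ _ hz => hz hw⟩

lemma apJoin_subset {t a b z : Finset ℤ} (hz : IsAP z) (hzt : z ⊆ t) (ha : a ⊆ z) (hb : b ⊆ z) :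
    apJoin t a b ⊆ z :=
  fun _ hw => (Finset.mem_filter.1 hw).2 z hz hzt (Finset.union_subset ha hb)

lemma subset_apJoin_of_forall {t a b s : Finset ℤ} (hst : s ⊆ t)
    (h : ∀ z, IsAP z → z ⊆ t → a ⊆ z → b ⊆ z → s ⊆ z) : s ⊆ apJoin t a b :=
  fun _ hw => Finset.mem_filter.2 ⟨hst hw, fun z hz hzt hab =>
    h z hz hzt (Finset.union_subset_left hab) (Finset.union_subset_right hab) hw⟩

/-- A coatom `c` satisfies the left-modular identity at `u ⊆ v` as soon as, when `u` is not
below `c`, every progression above `u` and `c ∩ v` is above `v`. -/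
lemma apJoin_inter_eq_of_coatom {y c u v : Finset ℤ} (hc : IsAP c) (hcy : c ⊂ y)
    (hcov : ¬ ∃ z : Finset ℤ, IsAP z ∧ c ⊂ z ∧ z ⊂ y) (hv : IsAP v) (huv : u ⊆ v) (hvy : v ⊆ y)
    (h : ¬ u ⊆ c → ∀ z, IsAP z → z ⊆ y → u ⊆ z → c ∩ v ⊆ z → v ⊆ z) :
    apJoin y u c ∩ v = apJoin y u (c ∩ v) := by
  have hcvy : c ∩ v ⊆ y := Finset.inter_subset_right.trans hvy
  have huy := huv.trans hvy
  have hle : apJoin y u (c ∩ v) ⊆ v := apJoin_subset hv hvy huv Finset.inter_subset_right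
  by_cases huc : u ⊆ c
  · refine Finset.Subset.antisymm ?_ (Finset.subset_inter ?_ hle)
    · exact (Finset.inter_subset_inter_right (apJoin_subset hc hcy.1 huc subset_rfl)).trans
        (Finset.union_subset_right (subset_apJoin huy hcvy))
    · exact (apJoin_subset hc hcy.1 huc Finset.inter_subset_left).trans
        (Finset.union_subset_right (subset_apJoin huy hcy.1))
  · have h1 : v ⊆ apJoin y u c := subset_apJoin_of_forall hvy fun z hz hzy huz hcz => by
      by_contra hvz
      exact hcov ⟨z, hz, ⟨hcz, fun hzc => huc (huz.trans hzc)⟩,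
        ⟨hzy, fun hyz => hvz (hvy.trans hyz)⟩⟩
    rw [Finset.inter_eq_right.2 h1]
    exact Finset.Subset.antisymm (subset_apJoin_of_forall hvy (h huc)) hle

/-- Removing from `y` an element outside `x` gives, if it is a progression, a left-modular coatom
of `[x, y]`. -/
lemma exists_leftModular_coatom_of_erase {x y : Finset ℤ} {m : ℤ} (hxy : x ⊆ y) (hmy : m ∈ y)
    (hmx : m ∉ x) (hm : IsAP (y.erase m)) :
    ∃ c : Finset ℤ, IsAP c ∧ x ⊆ c ∧ c ⊂ y ∧
      (¬ ∃ z : Finset ℤ, IsAP z ∧ c ⊂ z ∧ z ⊂ y) ∧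
      ∀ u v : Finset ℤ, IsAP u → IsAP v → x ⊆ u → u ⊂ v → v ⊆ y →
        apJoin y u c ∩ v = apJoin y u (c ∩ v) := by
  have hcov : ¬ ∃ z : Finset ℤ, IsAP z ∧ y.erase m ⊂ z ∧ z ⊂ y := by
    rintro ⟨z, -, h1, h2⟩
    have := Finset.card_lt_card h1
    have := Finset.card_lt_card h2
    have := Finset.card_erase_add_one hmy
    omega
  refine ⟨y.erase m, hm, Finset.subset_erase.2 ⟨hxy, hmx⟩, Finset.erase_ssubset hmy, hcov, ?_⟩
  intro u v _ hv _ huv hvy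
  refine apJoin_inter_eq_of_coatom hm (Finset.erase_ssubset hmy) hcov hv huv.1 hvy ?_
  intro huc z _ _ huz hcz w hw
  have hmu : m ∈ u := by
    by_contra hmu
    exact huc (Finset.subset_erase.2 ⟨huv.1.trans hvy, hmu⟩)
  obtain rfl | hwm := eq_or_ne w m
  · exact huz hmu
  · exact hcz (Finset.mem_inter.2 ⟨Finset.mem_erase.2 ⟨hwm, hvy hw⟩, hw⟩)

/-- Inclusion of progressions with the same endpoints `a` and `b` is divisibility of steps. -/
lemma step_dvd_of_subset {s t : Finset ℤ} {a b r q : ℤ} (hab : a < b) (hq1 : 1 ≤ q)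
    (hq : q ∣ b - a) (hs : ∀ w, w ∈ s ↔ a ≤ w ∧ w ≤ b ∧ r ∣ w - a)
    (ht : ∀ w, w ∈ t ↔ a ≤ w ∧ w ≤ b ∧ q ∣ w - a) (hts : t ⊆ s) : r ∣ q := by
  have hle := Int.le_of_dvd (by omega) hq
  have := ((hs (a + q)).1 (hts ((ht (a + q)).2 ⟨by omega, by omega, by simp⟩))).2.2
  simpa using this

lemma subset_of_step_dvd {s t : Finset ℤ} {a b r q : ℤ}
    (hs : ∀ w, w ∈ s ↔ a ≤ w ∧ w ≤ b ∧ r ∣ w - a)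
    (ht : ∀ w, w ∈ t ↔ a ≤ w ∧ w ≤ b ∧ q ∣ w - a) (h : r ∣ q) : t ⊆ s := fun w hw => by
  obtain ⟨h1, h2, h3⟩ := (ht w).1 hw
  exact (hs w).2 ⟨h1, h2, h.trans h3⟩

/-- If `x` contains both endpoints `a` and `b` of `y`, then a progression of step a prime multiple
of that of `y` is a left-modular coatom of `[x, y]`. -/
lemma exists_leftModular_coatom_of_endpoints_mem {x y : Finset ℤ} {a b : ℤ} (hx : IsAP x)
    (hy : IsAP y) (hxy : x ⊂ y) (hab : a < b) (hax : a ∈ x) (hbx : b ∈ x)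
    (hyab : ∀ w ∈ y, a ≤ w ∧ w ≤ b) :
    ∃ c : Finset ℤ, IsAP c ∧ x ⊆ c ∧ c ⊂ y ∧
      (¬ ∃ z : Finset ℤ, IsAP z ∧ c ⊂ z ∧ z ⊂ y) ∧
      ∀ u v : Finset ℤ, IsAP u → IsAP v → x ⊆ u → u ⊂ v → v ⊆ y →
        apJoin y u c ∩ v = apJoin y u (c ∩ v) := by
  have step : ∀ z, IsAP z → x ⊆ z → z ⊆ y →
      ∃ s : ℤ, 1 ≤ s ∧ s ∣ b - a ∧ ∀ w, w ∈ z ↔ a ≤ w ∧ w ≤ b ∧ s ∣ w - a :=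
    fun z hz hxz hzy => hz.exists_step (hxz hax) (hxz hbx) fun w hw => hyab w (hzy hw)
  obtain ⟨r, hr, hrd, hymem⟩ := step y hy hxy.1 subset_rfl
  obtain ⟨q, hq, hqd, hxmem⟩ := step x hx subset_rfl hxy.1
  obtain ⟨t, rfl⟩ := step_dvd_of_subset hab hq hqd hymem hxmem hxy.1
  have ht0 : 0 < t := by nlinarith
  have ht1 : t.natAbs ≠ 1 := fun h => by
    obtain rfl : t = 1 := by omega
    exact hxy.2 (subset_of_step_dvd hxmem hymem (by simp))
  obtain ⟨p, hp, hpt⟩ := Nat.exists_prime_and_dvd ht1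
  rw [← Int.natCast_dvd] at hpt
  have hpZ : Prime (p : ℤ) := Nat.prime_iff_prime_int.1 hp
  have hp2 : (2 : ℤ) ≤ p := by exact_mod_cast hp.two_le
  have hrp : 1 ≤ r * p := by nlinarith
  have hrpd : r * p ∣ b - a := (mul_dvd_mul_left r hpt).trans hqd
  obtain ⟨c, hcmem⟩ : ∃ c : Finset ℤ, ∀ w, w ∈ c ↔ a ≤ w ∧ w ≤ b ∧ r * p ∣ w - a :=
    ⟨(Finset.Icc a b).filter fun w => r * p ∣ w - a, fun w => by simp [and_assoc]⟩
  have hc : IsAP c := isAP_of_mem_iff hrp hcmem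
  have hxc : x ⊆ c := subset_of_step_dvd hcmem hxmem (mul_dvd_mul_left r hpt)
  have hr0 : r ≠ 0 := by omega
  have hcy : c ⊂ y := by
    refine ⟨subset_of_step_dvd hymem hcmem (dvd_mul_right _ _), fun hyc => ?_⟩
    have h := step_dvd_of_subset hab hr hrd hcmem hymem hyc
    have := Int.le_of_dvd (by omega) h
    nlinarith
  have hcov : ¬ ∃ z : Finset ℤ, IsAP z ∧ c ⊂ z ∧ z ⊂ y := by
    rintro ⟨z, hz, hcz, hzy⟩
    obtain ⟨s, hs, hsd, hzmem⟩ := step z hz (hxc.trans hcz.1) hzy.1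
    obtain ⟨d, rfl⟩ := step_dvd_of_subset hab hs hsd hymem hzmem hzy.1
    have hdp : d ∣ p := (mul_dvd_mul_iff_left hr0).1
      (step_dvd_of_subset hab hrp hrpd hzmem hcmem hcz.1)
    have hpd : ¬ (p : ℤ) ∣ d := fun h =>
      hcz.2 (subset_of_step_dvd hcmem hzmem (mul_dvd_mul_left r h))
    obtain ⟨e, he⟩ := hdp
    rcases hpZ.irreducible.isUnit_or_isUnit he with h | h
    · exact hzy.2 (subset_of_step_dvd hzmem hymem (h.mul_right_dvd.2 dvd_rfl))
    · exact hpd (he ▸ h.mul_right_dvd.2 dvd_rfl)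
  refine ⟨c, hc, hxc, hcy, hcov, fun u v hu hv hxu huv hvy => ?_⟩
  refine apJoin_inter_eq_of_coatom hc hcy hcov hv huv.1 hvy fun huc z hz hzy huz hcvz => ?_
  obtain ⟨U, hU, hUd, humem⟩ := step u hu hxu (huv.1.trans hvy)
  obtain ⟨V, hV, hVd, hvmem⟩ := step v hv (hxu.trans huv.1) hvy
  obtain ⟨d, hd, hdd, hzmem⟩ := step z hz (hxu.trans huz) hzy
  have hdU := step_dvd_of_subset hab hU hUd hzmem humem huz
  obtain ⟨V, rfl⟩ := step_dvd_of_subset hab hV hVd hymem hvmem hvy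
  obtain ⟨d, rfl⟩ := step_dvd_of_subset hab hd hdd hymem hzmem hzy
  have hpd : ¬ (p : ℤ) ∣ d := fun h => huc <|
    subset_of_step_dvd hcmem humem ((mul_dvd_mul_left r h).trans hdU)
  have hld : ((r * p).lcm (r * V) : ℤ) ∣ b - a := Int.coe_lcm_dvd hrpd hVd
  have hl0 : (1 : ℤ) ≤ (r * p).lcm (r * V) := by
    exact_mod_cast Nat.pos_of_ne_zero (Int.lcm_ne_zero (by omega) (by omega))
  have hll := Int.le_of_dvd (by omega) hld
  have hlz : a + ((r * p).lcm (r * V) : ℤ) ∈ z := hcvz <| Finset.mem_inter.2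
    ⟨(hcmem _).2 ⟨by omega, by omega, by simpa using Int.dvd_lcm_left _ _⟩,
      (hvmem _).2 ⟨by omega, by omega, by simpa using Int.dvd_lcm_right _ _⟩⟩
  have hdl : r * d ∣ ((r * p).lcm (r * V) : ℤ) := by simpa using ((hzmem _).1 hlz).2.2
  have hdpV : d ∣ p * V := (mul_dvd_mul_iff_left hr0).1 <| hdl.trans <|
    Int.coe_lcm_dvd ⟨V, by ring⟩ ⟨p, by ring⟩
  have hcop : IsCoprime d (p : ℤ) := ((hpZ.coprime_iff_not_dvd).2 hpd).symm
  exact subset_of_step_dvd hzmem hvmem (mul_dvd_mul_left r (hcop.dvd_of_dvd_mul_left hdpV))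

/-- For every `n ≥ 0`, the lattice `L_n` is comodernistic: every interval `[x, y]`
of `L_n` with `x < y` contains a coatom of `[x, y]` which is left-modular in the
lattice `[x, y]` (whose join is the smallest arithmetic progression contained in `y`
containing the union, and whose meet is intersection). -/
theorem Ln_comodernistic (n : ℕ) (x y : Finset ℤ) (hx : IsAP x) (hy : IsAP y)
    (hyn : y ⊆ Finset.Icc (1:ℤ) (n:ℤ)) (hxy : x ⊂ y) :
    ∃ c : Finset ℤ, IsAP c ∧ x ⊆ c ∧ c ⊂ y ∧
      (¬ ∃ z : Finset ℤ, IsAP z ∧ c ⊂ z ∧ z ⊂ y) ∧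
      ∀ u v : Finset ℤ, IsAP u → IsAP v → x ⊆ u → u ⊂ v → v ⊆ y →
        apJoin y u c ∩ v = apJoin y u (c ∩ v) := by
  obtain ⟨w, hwy, -⟩ := Finset.exists_of_ssubset hxy
  obtain ⟨a, b, r, hr, hab, hrd, hymem⟩ := hy.exists_mem_iff ⟨w, hwy⟩
  have hay : a ∈ y := (hymem a).2 ⟨le_rfl, hab, by simp⟩
  have hby : b ∈ y := (hymem b).2 ⟨hab, le_rfl, hrd⟩
  by_cases hax : a ∈ x
  · by_cases hbx : b ∈ x
    · refine exists_leftModular_coatom_of_endpoints_mem hx hy hxy (hab.lt_of_ne ?_) hax hbx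
        fun w hw => ⟨((hymem w).1 hw).1, ((hymem w).1 hw).2.1⟩
      rintro rfl
      refine hxy.2 fun w hw => ?_
      rwa [le_antisymm ((hymem w).1 hw).2.1 ((hymem w).1 hw).1]
    · refine exists_leftModular_coatom_of_erase hxy.1 hby hbx
        (isAP_of_mem_iff (a := a) (b := b - 1) hr fun w => ?_)
      rw [Finset.mem_erase, hymem]
      constructor
      · rintro ⟨h1, h2, h3, h4⟩
        exact ⟨h2, by omega, h4⟩
      · rintro ⟨h1, h2, h3⟩
        exact ⟨by omega, h1, by omega, h3⟩
  · refine exists_leftModular_coatom_of_erase hxy.1 hay hax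
      (isAP_of_mem_iff (a := a + r) (b := b) hr fun w => ?_)
    rw [Finset.mem_erase, hymem, ← sub_sub, dvd_sub_self_right]
    constructor
    · rintro ⟨h1, h2, h3, h4⟩
      have := Int.le_of_dvd (by omega) h4
      exact ⟨by omega, h3, h4⟩
    · rintro ⟨h1, h2, h3⟩
      exact ⟨by omega, by omega, h2, h3⟩
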